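/- arXiv:2404.13825 — 3 statements merged into one kernel-verified Lean document; each statement's English description precedes it below -/
import Mathlib

section
/- (Conditional variance of the BAR(1) model.) For every i ∈ S, the variance of the BAR(1) kernel at state i satisfies Σ_{j=0}^N j² · K(i,{j}) − (ρ i + N p(1−ρ))² = ρ(1−ρ)(1−2p) i + N p(1−ρ)(1 − p(1−ρ)). -/
open MeasureTheory Filter Finset Matrix

noncomputable section

/-- BAR(1) one-step transition probability `K(i,{j})` with parameters `(ρ, p)`,
where `β = p(1-ρ)` and `α = β + ρ`. -/
def barK (N : ℕ) (ρ p : ℝ) (i j : ℕ) : ℝ :=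
  ∑ k ∈ Finset.Icc (i + j - N) (min i j),
    (Nat.choose i k : ℝ) * (Nat.choose (N - i) (j - k)) *
      (p * (1 - ρ) + ρ) ^ k * (1 - (p * (1 - ρ) + ρ)) ^ (i - k) *
      (p * (1 - ρ)) ^ (j - k) * (1 - p * (1 - ρ)) ^ (N + k - (i + j))

/-- Binomial(N,p) probability mass function. -/
def binomPMF (N : ℕ) (p : ℝ) (i : ℕ) : ℝ :=
  (Nat.choose N i : ℝ) * p ^ i * (1 - p) ^ (N - i)

/-- CLS estimator of ρ from observations `x 0, …, x n`. -/
def clsRho (x : ℕ → ℝ) (n : ℕ) : ℝ :=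
  ((n : ℝ) * ∑ t ∈ Finset.Icc 1 n, x t * x (t - 1)
      - (∑ t ∈ Finset.Icc 1 n, x t) * (∑ t ∈ Finset.Icc 1 n, x (t - 1))) /
    ((n : ℝ) * ∑ t ∈ Finset.Icc 1 n, (x (t - 1)) ^ 2
      - (∑ t ∈ Finset.Icc 1 n, x (t - 1)) ^ 2)

/-- CLS estimator of p from observations `x 0, …, x n`. -/
def clsP (N : ℕ) (x : ℕ → ℝ) (n : ℕ) : ℝ :=
  ((∑ t ∈ Finset.Icc 1 n, x t) - clsRho x n * ∑ t ∈ Finset.Icc 1 n, x (t - 1)) /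
    ((n : ℝ) * N * (1 - clsRho x n))

/-- The real-valued observation sequence attached to a trajectory `ω`. -/
def xR (ω : ℕ → ℕ) (t : ℕ) : ℝ := (ω t : ℝ)

/-- Conditional variance σ²(i) of the BAR(1) model. -/
def sigmaSq (N : ℕ) (ρ p : ℝ) (i : ℕ) : ℝ :=
  ρ * (1 - ρ) * (1 - 2 * p) * i + N * p * (1 - ρ) * (1 - p * (1 - ρ))

/-- The matrix `W_CLS`. -/
def Wcls (N : ℕ) (ρ p : ℝ) : Matrix (Fin 2) (Fin 2) ℝ :=
  !![∑ i ∈ Finset.range (N + 1), binomPMF N p i * ((i : ℝ) - N * p) ^ 2 * sigmaSq N ρ p i,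
     (N : ℝ) * (1 - ρ) *
       ∑ i ∈ Finset.range (N + 1), binomPMF N p i * ((i : ℝ) - N * p) * sigmaSq N ρ p i;
     (N : ℝ) * (1 - ρ) *
       ∑ i ∈ Finset.range (N + 1), binomPMF N p i * ((i : ℝ) - N * p) * sigmaSq N ρ p i,
     (N : ℝ) ^ 2 * (1 - ρ) ^ 2 * ∑ i ∈ Finset.range (N + 1), binomPMF N p i * sigmaSq N ρ p i]

lemma binom_m0 (n : ℕ) (a : ℝ) :
    ∑ k ∈ Finset.range (n + 1), (Nat.choose n k : ℝ) * a ^ k * (1 - a) ^ (n - k) = 1 := by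
  have h := congrArg (Polynomial.eval a) (bernsteinPolynomial.sum ℝ n)
  simpa [Polynomial.eval_finsetSum, bernsteinPolynomial] using h

lemma binom_m1 (n : ℕ) (a : ℝ) :
    ∑ k ∈ Finset.range (n + 1), (k : ℝ) * ((Nat.choose n k : ℝ) * a ^ k * (1 - a) ^ (n - k))
      = n * a := by
  have h := congrArg (Polynomial.eval a) (bernsteinPolynomial.sum_smul ℝ n)
  simpa [Polynomial.eval_finsetSum, bernsteinPolynomial] using h

lemma cast_pred_mul (k : ℕ) : ((k * (k - 1) : ℕ) : ℝ) = (k : ℝ) * (k - 1) := by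
  cases k <;> simp

lemma binom_m2 (n : ℕ) (a : ℝ) :
    ∑ k ∈ Finset.range (n + 1), (k : ℝ) ^ 2 * ((Nat.choose n k : ℝ) * a ^ k * (1 - a) ^ (n - k))
      = n * (n - 1) * a ^ 2 + n * a := by
  have h := congrArg (Polynomial.eval a) (bernsteinPolynomial.sum_mul_smul ℝ n)
  simp only [Polynomial.eval_finsetSum, bernsteinPolynomial, nsmul_eq_mul, Polynomial.eval_mul,
    Polynomial.eval_natCast, Polynomial.eval_pow, Polynomial.eval_X, Polynomial.eval_sub,
    Polynomial.eval_one, cast_pred_mul] at h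
  rw [← h, ← binom_m1 n a, ← Finset.sum_add_distrib]
  refine Finset.sum_congr rfl fun k _ => ?_
  ring

lemma bar_sum (N : ℕ) (ρ p : ℝ) (i : ℕ) (hi : i ≤ N) :
    ∑ j ∈ Finset.range (N + 1), (j : ℝ) ^ 2 * barK N ρ p i j =
    ∑ k ∈ Finset.range (i + 1), ∑ m ∈ Finset.range (N - i + 1), ((k : ℝ) + m) ^ 2 *
      (((Nat.choose i k : ℝ) * (p * (1 - ρ) + ρ) ^ k * (1 - (p * (1 - ρ) + ρ)) ^ (i - k)) *
       ((Nat.choose (N - i) m : ℝ) * (p * (1 - ρ)) ^ m * (1 - p * (1 - ρ)) ^ (N - i - m))) := by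
  simp only [barK, Finset.mul_sum]
  rw [Finset.sum_sigma', Finset.sum_sigma']
  refine Finset.sum_bij' (fun x _ => ⟨x.2, x.1 - x.2⟩) (fun x _ => ⟨x.1 + x.2, x.1⟩) ?_ ?_ ?_ ?_ ?_
  · rintro ⟨j, k⟩ h
    simp only [Finset.mem_sigma, Finset.mem_range, Finset.mem_Icc, le_min_iff] at h ⊢
    omega
  · rintro ⟨k, m⟩ h
    simp only [Finset.mem_sigma, Finset.mem_range, Finset.mem_Icc, le_min_iff] at h ⊢
    omega
  · rintro ⟨j, k⟩ h
    simp only [Finset.mem_sigma, Finset.mem_range, Finset.mem_Icc, le_min_iff] at h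
    have : k + (j - k) = j := by omega
    simp [this]
  · rintro ⟨k, m⟩ h
    simp
  · rintro ⟨j, k⟩ h
    simp only [Finset.mem_sigma, Finset.mem_range, Finset.mem_Icc, le_min_iff] at h
    have h1 : N + k - (i + j) = N - i - (j - k) := by omega
    have h2 : (k : ℝ) + ((j - k : ℕ) : ℝ) = j := by
      rw [Nat.cast_sub (by omega)]; ring
    simp only [h1, h2]
    ring

/-- **Conditional variance of the BAR(1) model.**
For every state `i ∈ S = {0, …, N}`,
`Σ_{j=0}^N j² K(i,{j}) - (ρ i + N p (1-ρ))² = ρ(1-ρ)(1-2p) i + N p (1-ρ)(1 - p(1-ρ))`. -/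
theorem bar_conditional_variance
    (N : ℕ) (hN : 1 ≤ N) (p ρ : ℝ) (hp0 : 0 < p) (hp1 : p < 1)
    (hρl : max (-(p / (1 - p))) (-((1 - p) / p)) < ρ) (hρu : ρ < 1) :
    ∀ i ≤ N, (∑ j ∈ Finset.range (N + 1), (j : ℝ) ^ 2 * barK N ρ p i j)
        - (ρ * i + N * p * (1 - ρ)) ^ 2
      = ρ * (1 - ρ) * (1 - 2 * p) * i + N * p * (1 - ρ) * (1 - p * (1 - ρ)) := by
  intro i hi
  rw [bar_sum N ρ p i hi]
  have key : ∀ (n m : ℕ) (u v : ℕ → ℝ),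
      ∑ k ∈ Finset.range n, ∑ l ∈ Finset.range m, ((k : ℝ) + l) ^ 2 * (u k * v l) =
      (∑ k ∈ Finset.range n, (k : ℝ) ^ 2 * u k) * (∑ l ∈ Finset.range m, v l)
      + 2 * ((∑ k ∈ Finset.range n, (k : ℝ) * u k) * (∑ l ∈ Finset.range m, (l : ℝ) * v l))
      + (∑ k ∈ Finset.range n, u k) * (∑ l ∈ Finset.range m, (l : ℝ) ^ 2 * v l) := by
    intro n m u v
    rw [Finset.sum_mul_sum, Finset.sum_mul_sum, Finset.sum_mul_sum]
    simp only [Finset.mul_sum, ← Finset.sum_add_distrib]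
    refine Finset.sum_congr rfl fun k _ => Finset.sum_congr rfl fun l _ => ?_
    ring
  rw [key (i + 1) (N - i + 1)
    (fun k => (Nat.choose i k : ℝ) * (p * (1 - ρ) + ρ) ^ k * (1 - (p * (1 - ρ) + ρ)) ^ (i - k))
    (fun m => (Nat.choose (N - i) m : ℝ) * (p * (1 - ρ)) ^ m * (1 - p * (1 - ρ)) ^ (N - i - m))]
  simp only [binom_m0, binom_m1, binom_m2]
  rw [Nat.cast_sub hi]
  ring
end
end

section
/- (Strict stationarity of the BAR(1) process.) The shift map T : S^ℕ → S^ℕ, (T x)_t = x_{t+1}, is measure preserving for the trajectory law μ of the BAR(1) chain started from Binomial(N, p); that is, the BAR(1) process with initial distribution Binomial(N,p) is strictly stationary. -/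
open MeasureTheory Filter Finset Matrix

noncomputable section

open Polynomial in
lemma bar_coeff_lin (a b : ℝ) (n k : ℕ) :
    ((C a + C b * X : ℝ[X]) ^ n).coeff k = (Nat.choose n k : ℝ) * b ^ k * a ^ (n - k) := by
  rw [add_comm, add_pow, finsetSum_coeff]
  have h : ∀ m ∈ Finset.range (n + 1),
      ((C b * X) ^ m * (C a) ^ (n - m) * ((n.choose m : ℕ) : ℝ[X])).coeff k =
        if m = k then (Nat.choose n k : ℝ) * b ^ k * a ^ (n - k) else 0 := by
    intro m _
    have : (C b * X) ^ m * (C a) ^ (n - m) * ((n.choose m : ℕ) : ℝ[X]) =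
        C ((Nat.choose n m : ℝ) * b ^ m * a ^ (n - m)) * X ^ m := by
      simp only [mul_pow, map_mul, map_pow, map_natCast]
      ring
    rw [this, coeff_C_mul_X_pow]
    by_cases h : m = k
    · subst h; simp
    · rw [if_neg h, if_neg (fun h' => h h'.symm)]
  rw [Finset.sum_congr rfl h, Finset.sum_ite_eq']
  split_ifs with hk
  · rfl
  · have : n < k := by simpa using hk
    simp [Nat.choose_eq_zero_of_lt this]

open Polynomial in
lemma barK_eq_coeff (N : ℕ) (ρ p : ℝ) (i j : ℕ) (hi : i ≤ N) :
    barK N ρ p i j =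
      ((C (1 - (p * (1 - ρ) + ρ)) + C (p * (1 - ρ) + ρ) * X : ℝ[X]) ^ i *
        (C (1 - p * (1 - ρ)) + C (p * (1 - ρ)) * X : ℝ[X]) ^ (N - i)).coeff j := by
  rw [coeff_mul, Finset.Nat.sum_antidiagonal_eq_sum_range_succ_mk]
  simp only [bar_coeff_lin]
  unfold barK
  have hsub : Finset.Icc (i + j - N) (min i j) ⊆ Finset.range (j + 1) := by
    intro k hk
    simp only [Finset.mem_Icc, Finset.mem_range] at *
    omega
  rw [← Finset.sum_subset hsub]
  · apply Finset.sum_congr rfl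
    intro k hk
    simp only [Finset.mem_Icc] at hk
    have : N + k - (i + j) = N - i - (j - k) := by omega
    rw [this]
    ring
  · intro k hk hk'
    simp only [Finset.mem_Icc, Finset.mem_range] at hk hk'
    by_cases h : i < k
    · simp [Nat.choose_eq_zero_of_lt h]
    · have : N - i < j - k := by omega
      simp [Nat.choose_eq_zero_of_lt this]

open Polynomial in
lemma bar_invariant (N : ℕ) (ρ p : ℝ) (j : ℕ) :
    ∑ i ∈ Finset.range (N + 1), binomPMF N p i * barK N ρ p i j = binomPMF N p j := by
  have key : (C (1 - p) + C p * X : ℝ[X]) =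
      C p * (C (1 - (p * (1 - ρ) + ρ)) + C (p * (1 - ρ) + ρ) * X) +
      C (1 - p) * (C (1 - p * (1 - ρ)) + C (p * (1 - ρ)) * X) := by
    simp only [map_sub, map_add, map_mul, map_one]
    ring
  have h : binomPMF N p j = ((C (1 - p) + C p * X : ℝ[X]) ^ N).coeff j := by
    rw [bar_coeff_lin]; rfl
  rw [h, key, add_pow, finsetSum_coeff]
  apply Finset.sum_congr rfl
  intro i hi
  rw [barK_eq_coeff N ρ p i j (by simpa [Nat.lt_succ_iff] using hi), ← coeff_C_mul]
  congr 1
  unfold binomPMF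
  simp only [mul_pow, map_mul, map_pow, map_natCast]
  ring

lemma barK_nonneg (N : ℕ) (p ρ : ℝ) (hp0 : 0 < p) (hp1 : p < 1)
    (hρl : max (-(p / (1 - p))) (-((1 - p) / p)) < ρ) (hρu : ρ < 1) (i j : ℕ) :
    0 ≤ barK N ρ p i j := by
  have h1 : 0 < 1 - p := by linarith
  obtain ⟨ha, hb⟩ := max_lt_iff.1 hρl
  have hα : 0 ≤ p * (1 - ρ) + ρ := by
    have := mul_lt_mul_of_pos_right ha h1
    rw [neg_mul, div_mul_cancel₀ _ h1.ne'] at this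
    nlinarith
  have hβ' : 0 ≤ 1 - p * (1 - ρ) := by
    have := mul_lt_mul_of_pos_right hb hp0
    rw [neg_mul, div_mul_cancel₀ _ hp0.ne'] at this
    nlinarith
  have hα' : 0 ≤ 1 - (p * (1 - ρ) + ρ) := by nlinarith
  have hβ : 0 ≤ p * (1 - ρ) := by nlinarith
  unfold barK
  apply Finset.sum_nonneg
  intro k _
  positivity

lemma binomPMF_nonneg' (N : ℕ) (p : ℝ) (hp0 : 0 < p) (hp1 : p < 1) (i : ℕ) :
    0 ≤ binomPMF N p i := by
  have h1 : 0 ≤ 1 - p := by linarith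
  unfold binomPMF
  positivity

lemma measurableSet_cyl (n : ℕ) (x : ℕ → ℕ) :
    MeasurableSet {ω : ℕ → ℕ | ∀ t ≤ n, ω t = x t} := by
  have : {ω : ℕ → ℕ | ∀ t ≤ n, ω t = x t} =
      ⋂ t : ℕ, ⋂ _ : t ≤ n, (fun ω : ℕ → ℕ => ω t) ⁻¹' {x t} := by
    ext ω; simp
  rw [this]
  exact MeasurableSet.iInter fun t => MeasurableSet.iInter fun _ =>
    (measurable_pi_apply t) (measurableSet_singleton _)

lemma measure_ext_cyl (μ ν : Measure (ℕ → ℕ)) [IsProbabilityMeasure μ]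
    (h : ∀ (n : ℕ) (x : ℕ → ℕ),
      ν {ω | ∀ t ≤ n, ω t = x t} = μ {ω | ∀ t ≤ n, ω t = x t}) : ν = μ := by
  have hproj : IsProjectiveMeasureFamily (fun I : Finset ℕ => μ.map I.restrict) := by
    intro I J hJI
    simp only
    rw [Measure.map_map (by fun_prop) (by fun_prop)]
    rfl
  have hm : IsProjectiveLimit μ (fun I : Finset ℕ => μ.map I.restrict) := fun I => rfl
  have hn : IsProjectiveLimit ν (fun I : Finset ℕ => μ.map I.restrict) := by
    rw [isProjectiveLimit_nat_iff hproj]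
    intro n
    apply Measure.ext_of_singleton
    intro y
    rw [Measure.map_apply (by fun_prop) (measurableSet_singleton _),
      Measure.map_apply (by fun_prop) (measurableSet_singleton _)]
    have := h n (fun t => if ht : t ≤ n then y ⟨t, Finset.mem_Iic.2 ht⟩ else 0)
    have e : (Preorder.frestrictLe (π := fun _ : ℕ => ℕ) n) ⁻¹' {y} = {ω : ℕ → ℕ | ∀ t ≤ n,
        ω t = (fun t => if ht : t ≤ n then y ⟨t, Finset.mem_Iic.2 ht⟩ else 0) t} := by
      ext ω
      simp only [Set.mem_preimage, Set.mem_singleton_iff, Set.mem_setOf_eq]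
      constructor
      · rintro rfl t ht
        simp [ht]
      · intro hω
        ext ⟨t, ht⟩
        have ht' := Finset.mem_Iic.1 ht
        have := hω t ht'
        simpa [ht'] using this
    rw [← e] at this
    exact this
  exact hn.unique hm

/-- **Strict stationarity of the BAR(1) process.**
The shift map `T(ω)_t = ω_{t+1}` preserves the trajectory law `μ` of the BAR(1) chain
started from Binomial(N,p). -/
theorem bar_strictly_stationary
    (N : ℕ) (hN : 1 ≤ N) (p ρ : ℝ) (hp0 : 0 < p) (hp1 : p < 1)
    (hρl : max (-(p / (1 - p))) (-((1 - p) / p)) < ρ) (hρu : ρ < 1)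
    (μ : Measure (ℕ → ℕ)) [IsProbabilityMeasure μ]
    (hμ : ∀ (n : ℕ) (x : ℕ → ℕ),
      μ {ω | ∀ t ≤ n, ω t = x t} =
        ENNReal.ofReal (binomPMF N p (x 0) *
          ∏ t ∈ Finset.Icc 1 n, barK N ρ p (x (t - 1)) (x t))) :
    MeasurePreserving (fun ω : ℕ → ℕ => fun t => ω (t + 1)) μ μ := by
  have hT : Measurable (fun ω : ℕ → ℕ => fun t => ω (t + 1)) := by fun_prop
  refine ⟨hT, measure_ext_cyl _ _ fun n x => ?_⟩
  rw [Measure.map_apply hT (measurableSet_cyl n x), hμ n x]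
  let y : ℕ → ℕ → ℕ := fun i t => if t = 0 then i else x (t - 1)
  have hU : (fun ω : ℕ → ℕ => fun t => ω (t + 1)) ⁻¹' {ω | ∀ t ≤ n, ω t = x t} =
      ⋃ i, {ω : ℕ → ℕ | ∀ t ≤ n + 1, ω t = y i t} := by
    ext ω
    simp only [Set.mem_preimage, Set.mem_setOf_eq, Set.mem_iUnion]
    constructor
    · intro h
      refine ⟨ω 0, fun t ht => ?_⟩
      rcases t with _ | t
      · simp [y]
      · simpa [y] using h t (by omega)
    · rintro ⟨i, h⟩ t ht
      simpa [y] using h (t + 1) (by omega)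
  rw [hU, measure_iUnion _ (fun i => measurableSet_cyl _ _)]
  swap
  · intro i j hij
    refine Set.disjoint_left.2 fun ω hi hj => hij ?_
    have h1 := hi 0 (by omega)
    have h2 := hj 0 (by omega)
    simp only [y, if_true] at h1 h2
    exact h1.symm.trans h2
  have hprod : ∀ i, binomPMF N p (y i 0) *
      ∏ t ∈ Finset.Icc 1 (n + 1), barK N ρ p (y i (t - 1)) (y i t) =
      (binomPMF N p i * barK N ρ p i (x 0)) *
        ∏ t ∈ Finset.Icc 1 n, barK N ρ p (x (t - 1)) (x t) := by
    intro i
    have e : ∀ (m : ℕ) (f : ℕ → ℝ),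
        ∏ t ∈ Finset.Icc 1 m, f t = ∏ t ∈ Finset.range m, f (t + 1) := by
      intro m f
      induction m with
      | zero => simp
      | succ m ih => rw [Finset.prod_Icc_succ_top (by omega), ih, Finset.prod_range_succ]
    rw [e, e, Finset.prod_range_succ', mul_assoc]
    simp [y, mul_comm, mul_left_comm]
  simp only [hμ, hprod]
  have hP : 0 ≤ ∏ t ∈ Finset.Icc 1 n, barK N ρ p (x (t - 1)) (x t) :=
    Finset.prod_nonneg fun t _ => barK_nonneg N p ρ hp0 hp1 hρl hρu _ _
  rw [tsum_eq_sum (s := Finset.range (N + 1)), ← ENNReal.ofReal_sum_of_nonneg,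
    ← Finset.sum_mul, bar_invariant]
  · intro i _
    exact mul_nonneg (mul_nonneg (binomPMF_nonneg' N p hp0 hp1 i)
      (barK_nonneg N p ρ hp0 hp1 hρl hρu _ _)) hP
  · intro i hi
    have : N < i := by simpa using hi
    simp [binomPMF, Nat.choose_eq_zero_of_lt this]
end
end

section
/- (Autocovariance function of the stationary BAR(1) process.) For the canonical stationary BAR(1) chain with parameters (ρ, p), for every integer h ≥ 0, ∫ X_0 X_h dμ − (N p)² = ρ^h N p(1−p); that is, Cov(X_0, X_h) = ρ^h N p(1−p), so the lag-h autocorrelation equals ρ^h. -/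
open MeasureTheory Filter Finset Matrix

noncomputable section

theorem binomPMF_eq_bernstein (n : ℕ) (p : ℝ) (k : ℕ) :
    binomPMF n p k = (bernsteinPolynomial ℝ n k).eval p := by
  simp [binomPMF, bernsteinPolynomial]

theorem binom_sum_one (n : ℕ) (p : ℝ) :
    ∑ k ∈ Finset.range (n + 1), binomPMF n p k = 1 := by
  have := congrArg (Polynomial.eval p) (bernsteinPolynomial.sum ℝ n)
  simpa [Polynomial.eval_finsetSum, binomPMF_eq_bernstein] using this

theorem binom_sum_id (n : ℕ) (p : ℝ) :
    ∑ k ∈ Finset.range (n + 1), (k : ℝ) * binomPMF n p k = n * p := by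
  have := congrArg (Polynomial.eval p) (bernsteinPolynomial.sum_smul ℝ n)
  simpa [Polynomial.eval_finsetSum, binomPMF_eq_bernstein] using this

theorem binom_sum_sq (n : ℕ) (p : ℝ) :
    ∑ k ∈ Finset.range (n + 1), ((k : ℝ) * k) * binomPMF n p k =
      n * p * (1 - p) + (n * p) ^ 2 := by
  have h2 := congrArg (Polynomial.eval p) (bernsteinPolynomial.sum_mul_smul ℝ n)
  have h1 := binom_sum_id n p
  have cast : ∀ k : ℕ, ((k * (k - 1) : ℕ) : ℝ) = (k : ℝ) * k - k := by
    intro k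
    cases k with
    | zero => simp
    | succ m => push_cast [Nat.add_sub_cancel]; ring
  simp only [Polynomial.eval_finsetSum, nsmul_eq_mul, Polynomial.eval_mul, Polynomial.eval_natCast,
    Polynomial.eval_pow, Polynomial.eval_X, ← binomPMF_eq_bernstein, cast, sub_mul,
    Finset.sum_sub_distrib] at h2
  rw [h1] at h2
  linear_combination h2

theorem barK_mean (N : ℕ) (ρ p : ℝ) (i : ℕ) (hi : i ≤ N) :
    ∑ j ∈ Finset.range (N + 1), (j : ℝ) * barK N ρ p i j = ρ * i + N * (p * (1 - ρ)) := by
  have key : ∑ j ∈ Finset.range (N + 1), (j : ℝ) * barK N ρ p i j =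
      ∑ k ∈ Finset.range (i + 1), ∑ l ∈ Finset.range (N - i + 1),
        ((k : ℝ) + l) * (binomPMF i (p * (1 - ρ) + ρ) k * binomPMF (N - i) (p * (1 - ρ)) l) := by
    simp only [barK, Finset.mul_sum]
    rw [Finset.sum_sigma', Finset.sum_sigma']
    refine Finset.sum_bij' (fun a _ => ⟨a.2, a.1 - a.2⟩) (fun a _ => ⟨a.1 + a.2, a.1⟩) ?_ ?_ ?_ ?_ ?_
    · rintro ⟨j, k⟩ h
      simp only [Finset.mem_sigma, Finset.mem_range, Finset.mem_Icc] at h ⊢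
      omega
    · rintro ⟨k, l⟩ h
      simp only [Finset.mem_sigma, Finset.mem_range, Finset.mem_Icc] at h ⊢
      omega
    · rintro ⟨j, k⟩ h
      simp only [Finset.mem_sigma, Finset.mem_range, Finset.mem_Icc] at h ⊢
      have : k + (j - k) = j := by omega
      simp [this]
    · rintro ⟨k, l⟩ h
      simp
    · rintro ⟨j, k⟩ h
      simp only [Finset.mem_sigma, Finset.mem_range, Finset.mem_Icc] at h ⊢
      have h1 : N + k - (i + j) = N - i - (j - k) := by omega
      have h2 : (j : ℝ) = k + ((j - k : ℕ) : ℝ) := by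
        rw [Nat.cast_sub (by omega)]; ring
      rw [h1, ← h2]
      simp only [binomPMF]
      ring
  rw [key]
  have e : ∀ k l : ℕ, ((k : ℝ) + l) *
      (binomPMF i (p * (1 - ρ) + ρ) k * binomPMF (N - i) (p * (1 - ρ)) l) =
      (k * binomPMF i (p * (1 - ρ) + ρ) k) * binomPMF (N - i) (p * (1 - ρ)) l +
      binomPMF i (p * (1 - ρ) + ρ) k * (l * binomPMF (N - i) (p * (1 - ρ)) l) := by
    intros; ring
  simp only [e, Finset.sum_add_distrib, ← Finset.mul_sum, ← Finset.sum_mul, binom_sum_one,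
    binom_sum_id]
  rw [Nat.cast_sub hi]
  ring

theorem barK_nonneg_s14 (N : ℕ) (ρ p : ℝ) (h1 : 0 ≤ p * (1 - ρ) + ρ) (h2 : p * (1 - ρ) + ρ ≤ 1)
    (h3 : 0 ≤ p * (1 - ρ)) (h4 : p * (1 - ρ) ≤ 1) (i j : ℕ) : 0 ≤ barK N ρ p i j := by
  have := sub_nonneg.2 h2
  have := sub_nonneg.2 h4
  unfold barK
  exact Finset.sum_nonneg fun k _ => by positivity

theorem barK_zero (N : ℕ) (ρ p : ℝ) (i j : ℕ) (hi : i ≤ N) (hj : N < j) :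
    barK N ρ p i j = 0 := by
  unfold barK
  rw [Finset.Icc_eq_empty (by omega), Finset.sum_empty]

open scoped ENNReal in
/-- One-step Markov property in integrated form. -/
theorem bar_step (N : ℕ) (p ρ : ℝ) (hK : ∀ i j, 0 ≤ barK N ρ p i j)
    (hB : ∀ i, 0 ≤ binomPMF N p i)
    (μ : Measure (ℕ → ℕ))
    (hμ : ∀ (n : ℕ) (x : ℕ → ℕ),
      μ {ω | ∀ t ≤ n, ω t = x t} =
        ENNReal.ofReal (binomPMF N p (x 0) *
          ∏ t ∈ Finset.Icc 1 n, barK N ρ p (x (t - 1)) (x t)))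
    (n : ℕ) (f g : ℕ → ℝ≥0∞) :
    ∫⁻ ω, f (ω 0) * g (ω (n + 1)) ∂μ =
      ∫⁻ ω, f (ω 0) * ∑' b, g b * ENNReal.ofReal (barK N ρ p (ω n) b) ∂μ := by
  let r : (ℕ → ℕ) → (Fin (n + 1) → ℕ) := fun ω i => ω i
  let s : (ℕ → ℕ) → (Fin (n + 1) → ℕ) × ℕ := fun ω => (r ω, ω (n + 1))
  have hr : Measurable r := by fun_prop
  have hs : Measurable s := by fun_prop
  have e1 : ∫⁻ ω, f (ω 0) * g (ω (n + 1)) ∂μ =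
      ∫⁻ z, f (z.1 0) * g z.2 ∂(μ.map s) := by
    rw [lintegral_map (measurable_of_countable _) hs]; rfl
  have e2 : ∫⁻ ω, f (ω 0) * ∑' b, g b * ENNReal.ofReal (barK N ρ p (ω n) b) ∂μ =
      ∫⁻ y, f (y 0) * ∑' b, g b * ENNReal.ofReal (barK N ρ p (y (Fin.last n)) b) ∂(μ.map r) := by
    rw [lintegral_map (measurable_of_countable _) hr]; rfl
  rw [e1, e2, lintegral_countable', lintegral_countable', ENNReal.tsum_prod']
  refine tsum_congr fun y => ?_
  rw [← ENNReal.tsum_mul_left, ← ENNReal.tsum_mul_right]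
  refine tsum_congr fun b => ?_
  rw [Measure.map_apply hs (measurableSet_singleton _),
    Measure.map_apply hr (measurableSet_singleton _)]
  let x : ℕ → ℕ := fun t => if h : t < n + 1 then y ⟨t, h⟩ else b
  have hx : ∀ t (h : t < n + 1), x t = y ⟨t, h⟩ := fun t h => dif_pos h
  have hxb : x (n + 1) = b := by simp [x]
  have hsr : r ⁻¹' {y} = {ω | ∀ t ≤ n, ω t = x t} := by
    ext ω
    simp only [Set.mem_preimage, Set.mem_singleton_iff, Set.mem_ofPred_eq, funext_iff, r]
    constructor
    · intro h t ht
      rw [hx t (by omega), ← h]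
    · intro h t
      rw [h t (by omega), hx t t.2]
  have hss : s ⁻¹' {(y, b)} = {ω | ∀ t ≤ n + 1, ω t = x t} := by
    have : s ⁻¹' {(y, b)} = r ⁻¹' {y} ∩ {ω | ω (n + 1) = b} := by
      ext ω; simp [s]
    rw [this, hsr]
    ext ω
    simp only [Set.mem_inter_iff, Set.mem_ofPred_eq]
    constructor
    · rintro ⟨h, h'⟩ t ht
      rcases Nat.lt_or_ge n t with h2 | h2
      · obtain rfl : t = n + 1 := by omega
        rw [h', hxb]
      · exact h t h2
    · intro h
      exact ⟨fun t ht => h t (by omega), by rw [h _ le_rfl, hxb]⟩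
  rw [hsr, hss, hμ, hμ, Finset.prod_Icc_succ_top (by omega), ← mul_assoc,
    ENNReal.ofReal_mul (mul_nonneg (hB _) (Finset.prod_nonneg fun _ _ => hK _ _))]
  simp only [Nat.add_sub_cancel, hxb]
  have : x n = y (Fin.last n) := hx n (by omega)
  rw [this]
  ring

/-- **Autocovariance function of the stationary BAR(1) process.**
For every lag `h ≥ 0`, `∫ X_0 X_h dμ - (N p)² = ρ^h N p (1-p)`. -/
theorem bar_autocovariance
    (N : ℕ) (hN : 1 ≤ N) (p ρ : ℝ) (hp0 : 0 < p) (hp1 : p < 1)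
    (hρl : max (-(p / (1 - p))) (-((1 - p) / p)) < ρ) (hρu : ρ < 1)
    (μ : Measure (ℕ → ℕ)) [IsProbabilityMeasure μ]
    (hμ : ∀ (n : ℕ) (x : ℕ → ℕ),
      μ {ω | ∀ t ≤ n, ω t = x t} =
        ENNReal.ofReal (binomPMF N p (x 0) *
          ∏ t ∈ Finset.Icc 1 n, barK N ρ p (x (t - 1)) (x t))) :
    ∀ h : ℕ, (∫ ω, xR ω 0 * xR ω h ∂μ) - (N * p) ^ 2 = ρ ^ h * (N * p * (1 - p)) := by
  intro h
  have hq : 0 < 1 - p := by linarith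
  obtain ⟨hl1, hl2⟩ := max_lt_iff.1 hρl
  rw [← neg_div, div_lt_iff₀ hq] at hl1
  rw [← neg_div, div_lt_iff₀ hp0] at hl2
  have hβ0 : 0 ≤ p * (1 - ρ) := mul_nonneg hp0.le (by linarith)
  have hβ1 : p * (1 - ρ) ≤ 1 := by nlinarith
  have hα0 : 0 ≤ p * (1 - ρ) + ρ := by nlinarith
  have hα1 : p * (1 - ρ) + ρ ≤ 1 := by nlinarith
  have hK := barK_nonneg_s14 N ρ p hα0 hα1 hβ0 hβ1
  have hB : ∀ i, 0 ≤ binomPMF N p i := fun i => by unfold binomPMF; positivity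
  have step := bar_step N p ρ hK hB μ hμ
  -- law of the initial state
  have h0 : ∀ i, μ.map (fun ω => ω 0) {i} = ENNReal.ofReal (binomPMF N p i) := by
    intro i
    rw [Measure.map_apply (measurable_pi_apply 0) (measurableSet_singleton _)]
    have := hμ 0 (fun _ => i)
    simpa [Set.preimage] using this
  -- the chain stays in the state space
  have hae : ∀ n, ∀ᵐ ω ∂μ, ω n ≤ N := by
    intro n
    induction n with
    | zero =>
      have : ∀ᵐ k ∂(μ.map (fun ω => ω 0)), k ≤ N := by
        rw [ae_iff_of_countable]
        intro k hk
        by_contra hkN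
        apply hk
        rw [h0, binomPMF, Nat.choose_eq_zero_of_lt (by omega)]
        simp
      exact ae_of_ae_map (measurable_pi_apply 0).aemeasurable this
    | succ n ih =>
      have hst := step n (fun _ => 1) (fun b => if N < b then 1 else 0)
      have hz : ∫⁻ ω, (1 : ENNReal) * ∑' b, (if N < b then 1 else 0) *
          ENNReal.ofReal (barK N ρ p (ω n) b) ∂μ = 0 := by
        rw [← lintegral_zero (μ := μ)]
        apply lintegral_congr_ae
        filter_upwards [ih] with ω hω
        rw [one_mul, ENNReal.tsum_eq_zero]
        intro b
        split_ifs with hb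
        · rw [barK_zero N ρ p _ _ hω hb]; simp
        · simp
      have hme : Measurable fun ω : ℕ → ℕ => (1 : ENNReal) * if N < ω (n + 1) then 1 else 0 :=
        (measurable_of_countable (fun b : ℕ => (1 : ENNReal) * if N < b then 1 else 0)).comp
          (measurable_pi_apply (X := fun _ : ℕ => ℕ) (n + 1))
      rw [hz, lintegral_eq_zero_iff hme] at hst
      filter_upwards [hst] with ω hω
      by_contra hc
      simp [not_le.1 hc] at hω
  have hmeas : ∀ n, Measurable fun ω : ℕ → ℕ => (ω n : ℝ) := fun n =>
    (measurable_of_countable (fun k : ℕ => (k : ℝ))).comp (measurable_pi_apply n)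
  have hInteg1 : ∀ n, Integrable (fun ω : ℕ → ℕ => (ω n : ℝ)) μ := fun n => by
    refine Integrable.of_bound (hmeas n).aestronglyMeasurable (N : ℝ) ?_
    filter_upwards [hae n] with ω hω
    simpa using hω
  have hInteg2 : ∀ n, Integrable (fun ω : ℕ → ℕ => (ω 0 : ℝ) * ω n) μ := fun n => by
    refine Integrable.of_bound ((hmeas 0).mul (hmeas n)).aestronglyMeasurable ((N : ℝ) * N) ?_
    filter_upwards [hae 0, hae n] with ω hω hω'
    rw [Real.norm_of_nonneg (by positivity)]
    exact_mod_cast Nat.mul_le_mul hω hω'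
  -- moments of the initial state
  have hinit : ∀ F : ℕ → ℝ, (∀ k, 0 ≤ F k) →
      ∫ ω, F (ω 0) ∂μ = ∑ k ∈ Finset.range (N + 1), F k * binomPMF N p k := by
    intro F hF
    have hFm : Measurable fun ω : ℕ → ℕ => F (ω 0) :=
      (measurable_of_countable F).comp (measurable_pi_apply 0)
    rw [integral_eq_lintegral_of_nonneg_ae (Eventually.of_forall fun ω => hF _)
      hFm.aestronglyMeasurable]
    have : ∫⁻ ω, ENNReal.ofReal (F (ω 0)) ∂μ =
        ∫⁻ k, ENNReal.ofReal (F k) ∂(μ.map (fun ω => ω 0)) := by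
      rw [lintegral_map (measurable_of_countable _) (measurable_pi_apply 0)]
    rw [this, lintegral_countable', tsum_eq_sum (s := Finset.range (N + 1))]
    · simp only [h0, ← ENNReal.ofReal_mul (hF _)]
      rw [← ENNReal.ofReal_sum_of_nonneg fun k _ => mul_nonneg (hF k) (hB k),
        ENNReal.toReal_ofReal (Finset.sum_nonneg fun k _ => mul_nonneg (hF k) (hB k))]
    · intro k hk
      rw [h0, binomPMF, Nat.choose_eq_zero_of_lt (by simpa using hk)]
      simp
  -- recursion
  have hrec : ∀ n, ∫ ω, (ω 0 : ℝ) * ω (n + 1) ∂μ =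
      ∫ ω, (ω 0 : ℝ) * (ρ * ω n + N * (p * (1 - ρ))) ∂μ := by
    intro n
    have hnn : ∀ i, i ≤ N → 0 ≤ ρ * i + N * (p * (1 - ρ)) := fun i hi => by
      rw [← barK_mean N ρ p i hi]
      exact Finset.sum_nonneg fun j _ => mul_nonneg (Nat.cast_nonneg _) (hK _ _)
    have hnn' : 0 ≤ᵐ[μ] fun ω : ℕ → ℕ => (ω 0 : ℝ) * ω (n + 1) :=
      Eventually.of_forall fun ω => mul_nonneg (Nat.cast_nonneg _) (Nat.cast_nonneg _)
    rw [integral_eq_lintegral_of_nonneg_ae hnn' (hInteg2 (n + 1)).aestronglyMeasurable,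
      integral_eq_lintegral_of_nonneg_ae]
    · congr 1
      have := step n (fun k => ENNReal.ofReal k) (fun k => ENNReal.ofReal k)
      simp only [ENNReal.ofReal_mul (Nat.cast_nonneg _)]
      rw [this]
      apply lintegral_congr_ae
      filter_upwards [hae n] with ω hω
      congr 1
      rw [tsum_eq_sum (s := Finset.range (N + 1)), ← barK_mean N ρ p _ hω,
        ENNReal.ofReal_sum_of_nonneg fun j _ => mul_nonneg (Nat.cast_nonneg _) (hK _ _)]
      · simp only [ENNReal.ofReal_mul (Nat.cast_nonneg _)]
      · intro b hb
        rw [barK_zero N ρ p _ _ hω (by simpa using hb)]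
        simp
    · filter_upwards [hae n] with ω hω
      exact mul_nonneg (Nat.cast_nonneg _) (hnn _ hω)
    · exact ((hmeas 0).mul (((hmeas n).const_mul ρ).add_const _)).aestronglyMeasurable
  simp only [xR]
  induction h with
  | zero =>
    rw [hinit (fun k => (k : ℝ) * k) (fun k => by positivity), binom_sum_sq]
    ring
  | succ n ih =>
    have hm : ∫ ω, (ω 0 : ℝ) ∂μ = N * p := by
      rw [hinit (fun k => (k : ℝ)) (fun k => by positivity), binom_sum_id]
    have : ∫ ω, (ω 0 : ℝ) * (ρ * ω n + N * (p * (1 - ρ))) ∂μ =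
        ρ * ∫ ω, (ω 0 : ℝ) * ω n ∂μ + N * (p * (1 - ρ)) * ∫ ω, (ω 0 : ℝ) ∂μ := by
      rw [← integral_const_mul, ← integral_const_mul,
        ← integral_add ((hInteg2 n).const_mul _) ((hInteg1 0).const_mul _)]
      congr 1
      ext ω
      ring
    rw [hrec, this, hm, pow_succ]
    linear_combination ρ * ih
end
end
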